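/- arXiv:1709.03909 — 2 statements merged into one kernel-verified Lean document; each statement's English description precedes it below -/
import Mathlib

section
/- Let n ≥ 3 and let s, t be real numbers with t > n/2 − 1 and s + t < 1 − n/2. Then for every v ∈ Λ_n the integral ∫_{Λ_n} Δ(y+v)^s Δ(y)^{t−n/2} dy is finite, and there is a constant C_{s,t} > 0, depending only on s, t and n, such that ∫_{Λ_n} Δ(y+v)^s Δ(y)^{t−n/2} dy = C_{s,t} Δ(v)^{s+t} for every v ∈ Λ_n. (This is the scalar-exponent case of the paper's Lemma 3.1 for the rank-2 Lorentz cone: with r = 2 and d = n − 2, the paper's conditions Re t_j > (r−j)d/2 for all j and Re(s_j + t_j) < −(j−1)d/2 for all j reduce to t > n/2 − 1 and s + t < 1 − n/2.) -/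
open MeasureTheory ENNReal

noncomputable section

/-- The Lorentz determinant `Δ(y) = y₁² − y₂² − ⋯ − y_n²`. -/
def lDelta (n : ℕ) [NeZero n] (y : Fin n → ℝ) : ℝ :=
  2 * y 0 ^ 2 - ∑ i, y i ^ 2

/-- The Lorentz cone `Λ_n`. -/
def lCone (n : ℕ) [NeZero n] : Set (Fin n → ℝ) :=
  {y | 0 < lDelta n y ∧ 0 < y 0}

open Set in
theorem integrableOn_rpow_mul_one_add_rpow {a s : ℝ} (ha : -1 < a) (hs : a + s < -1) :
    IntegrableOn (fun u : ℝ => u ^ a * (1 + u) ^ s) (Ioi 0) := by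
  have meas (A : Set ℝ) : AEStronglyMeasurable (fun u : ℝ => u ^ a * (1 + u) ^ s)
      (volume.restrict A) := by
    refine Measurable.aestronglyMeasurable ?_
    fun_prop
  rw [← Ioc_union_Ioi_eq_Ioi zero_le_one]
  refine IntegrableOn.union ?_ ?_
  · have h := (intervalIntegrable_iff_integrableOn_Ioc_of_le zero_le_one).1
      (intervalIntegral.intervalIntegrable_rpow' (a := 0) (b := 1) ha)
    refine (h.const_mul (max 1 (2 ^ s))).mono' (meas _) ?_
    refine (ae_restrict_mem measurableSet_Ioc).mono fun u hu => ?_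
    have hu0 : 0 < u := hu.1
    rw [Real.norm_of_nonneg (by positivity), mul_comm]
    gcongr
    rcases le_total 0 s with h | h
    · exact le_max_of_le_right (Real.rpow_le_rpow (by linarith) (by linarith [hu.2]) h)
    · exact le_max_of_le_left (Real.rpow_le_one_of_one_le_of_nonpos (by linarith) h)
  · have h := integrableOn_Ioi_rpow_of_lt hs one_pos
    refine (h.const_mul (max 1 (2 ^ s))).mono' (meas _) ?_
    refine (ae_restrict_mem measurableSet_Ioi).mono fun u (hu : 1 < u) => ?_
    have hu0 : 0 < u := by linarith
    rw [Real.norm_of_nonneg (by positivity), Real.rpow_add hu0, mul_left_comm]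
    gcongr
    rcases le_total 0 s with h | h
    · calc (1 + u) ^ s ≤ (2 * u) ^ s := Real.rpow_le_rpow (by linarith) (by linarith) h
        _ = 2 ^ s * u ^ s := Real.mul_rpow (by norm_num) hu0.le
        _ ≤ _ := by gcongr; exact le_max_right _ _
    · calc (1 + u) ^ s ≤ u ^ s := Real.rpow_le_rpow_of_nonpos hu0 (by linarith) h
        _ = 1 * u ^ s := (one_mul _).symm
        _ ≤ _ := by gcongr; exact le_max_left _ _

/-- Polar coordinates in the second factor. -/
theorem integrable_prod_fun_norm {E : Type*} [NormedAddCommGroup E] [NormedSpace ℝ E]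
    [FiniteDimensional ℝ E] [MeasurableSpace E] [BorelSpace E] [Nontrivial E]
    (μ : Measure E) [μ.IsAddHaarMeasure] {f : ℝ × ℝ → ℝ} (hf : Measurable f)
    (h : Integrable (fun q : ℝ × ℝ => q.2 ^ (Module.finrank ℝ E - 1) * f q)
      (volume.prod (volume.restrict (Set.Ioi 0)))) :
    Integrable (fun p : ℝ × E => f (p.1, ‖p.2‖)) (volume.prod μ) := by
  have hm : Measurable fun p : ℝ × E => f (p.1, ‖p.2‖) := by fun_prop
  rw [integrable_prod_iff hm.aestronglyMeasurable]
  constructor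
  · filter_upwards [h.prod_right_ae] with x hx
    exact (integrable_fun_norm_addHaar μ (f := fun r => f (x, r))).2 hx
  · refine ((h.norm.integral_prod_left.const_mul
      (Module.finrank ℝ E * μ.real (Metric.ball 0 1)))).congr (.of_forall fun x => ?_)
    simp only
    rw [integral_fun_norm_addHaar μ (fun r => ‖f (x, r)‖), nsmul_eq_mul, smul_eq_mul, ← mul_assoc]
    congr 1
    refine setIntegral_congr_fun measurableSet_Ioi fun r (hr : 0 < r) => ?_
    simp [abs_of_pos hr]

theorem integrable_comp_sub_add {f : ℝ × ℝ → ℝ} (hf : Integrable f) :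
    Integrable fun q : ℝ × ℝ => f (q.1 - q.2, q.1 + q.2) := by
  let L : ℝ × ℝ →ₗ[ℝ] ℝ × ℝ :=
    (LinearMap.fst ℝ ℝ ℝ - LinearMap.snd ℝ ℝ ℝ).prod (LinearMap.fst ℝ ℝ ℝ + LinearMap.snd ℝ ℝ ℝ)
  let M : ℝ × ℝ →ₗ[ℝ] ℝ × ℝ :=
    (LinearMap.fst ℝ ℝ ℝ + LinearMap.snd ℝ ℝ ℝ).prod (LinearMap.snd ℝ ℝ ℝ - LinearMap.fst ℝ ℝ ℝ)
  have hML : M ∘ₗ L = (2 : ℝ) • LinearMap.id := by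
    ext <;> norm_num [M, L]
  have hdet : LinearMap.det L ≠ 0 := by
    intro h0
    have := congrArg LinearMap.det hML
    rw [LinearMap.det_comp, h0, LinearMap.det_smul] at this
    norm_num at this
  have hL : Measurable L := L.continuous_of_finiteDimensional.measurable
  have h : Integrable f (Measure.map L volume) := by
    rw [Measure.map_linearMap_addHaar_eq_smul_addHaar _ hdet]
    exact hf.smul_measure ENNReal.ofReal_ne_top
  exact h.comp_measurable hL

/-- The cone in the coordinates `(y₁, |(y₂, …, y_n)|)`. -/
def radialCone : Set (ℝ × ℝ) :=
  {q | 0 < q.1 ^ 2 - q.2 ^ 2 ∧ 0 < q.1}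

/-- The integrand at the base point in the coordinates `(y₁, |(y₂, …, y_n)|)`, extended by zero. -/
def radialIntegrand (s a : ℝ) (q : ℝ × ℝ) : ℝ :=
  radialCone.indicator
    (fun q => ((q.1 + 1) ^ 2 - q.2 ^ 2) ^ s * (q.1 ^ 2 - q.2 ^ 2) ^ a) q

theorem measurable_radialIntegrand (s a : ℝ) : Measurable (radialIntegrand s a) := by
  have h : Measurable fun q : ℝ × ℝ =>
      ((q.1 + 1) ^ 2 - q.2 ^ 2) ^ s * (q.1 ^ 2 - q.2 ^ 2) ^ a := by fun_prop
  refine h.indicator ?_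
  have h' : Measurable fun q : ℝ × ℝ => q.1 ^ 2 - q.2 ^ 2 := by fun_prop
  exact (measurableSet_lt measurable_const h').inter
    (measurableSet_lt measurable_const measurable_fst)

theorem integrable_pow_mul_radialIntegrand {s a : ℝ} (k : ℕ) (ha : -1 < a)
    (hs : a + k + s < -1) :
    Integrable (fun q : ℝ × ℝ => q.2 ^ k * radialIntegrand s a q)
      (volume.prod (volume.restrict (Set.Ioi 0))) := by
  have hk : (0 : ℝ) ≤ k := k.cast_nonneg
  have h₁ := (integrable_indicator_iff measurableSet_Ioi).2
    (integrableOn_rpow_mul_one_add_rpow ha (by linarith : a + s < -1))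
  have h₂ := (integrable_indicator_iff measurableSet_Ioi).2
    (integrableOn_rpow_mul_one_add_rpow (by linarith : -1 < a + k) hs)
  have h := integrable_comp_sub_add (h₁.mul_prod h₂)
  have hμ : (volume : Measure ℝ).prod (volume.restrict (Set.Ioi (0 : ℝ))) =
      (volume : Measure (ℝ × ℝ)).restrict (Set.univ ×ˢ Set.Ioi 0) := by
    rw [Measure.volume_eq_prod, ← Measure.prod_restrict, Measure.restrict_univ]
  rw [hμ]
  refine (h.integrableOn (s := Set.univ ×ˢ Set.Ioi 0)).mono' ?_ ?_
  · exact ((measurable_snd.pow_const k).mul (measurable_radialIntegrand s a)).aestronglyMeasurable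
  · refine (ae_restrict_mem (MeasurableSet.univ.prod measurableSet_Ioi)).mono ?_
    rintro ⟨p, q⟩ ⟨-, (hq : 0 < q)⟩
    by_cases hpq : (p, q) ∈ radialCone
    · have hp : 0 < p := hpq.2
      have hu : 0 < p - q := by
        have := abs_lt_of_sq_lt_sq (sub_pos.1 hpq.1 : q ^ 2 < p ^ 2) hp.le
        linarith [le_abs_self q]
      have hw : 0 < p + q := by linarith [hp]
      have e₁ : (p + 1) ^ 2 - q ^ 2 = (1 + (p - q)) * (1 + (p + q)) := by ring
      have e₂ : p ^ 2 - q ^ 2 = (p - q) * (p + q) := by ring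
      rw [radialIntegrand, Set.indicator_of_mem hpq, Set.indicator_of_mem (Set.mem_Ioi.2 hu),
        Set.indicator_of_mem (Set.mem_Ioi.2 hw)]
      simp only
      rw [e₁, e₂, Real.mul_rpow (by linarith) (by linarith), Real.mul_rpow hu.le hw.le,
        Real.norm_of_nonneg (by positivity), Real.rpow_add hw, Real.rpow_natCast]
      calc _ ≤ (p + q) ^ k * ((1 + (p - q)) ^ s * (1 + (p + q)) ^ s *
            ((p - q) ^ a * (p + q) ^ a)) := by gcongr; linarith [hp]
        _ = _ := by ring
    · rw [radialIntegrand, Set.indicator_of_notMem hpq, mul_zero, norm_zero]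
      refine mul_nonneg ?_ ?_ <;> refine Set.indicator_nonneg (fun x (hx : 0 < x) => ?_) _ <;>
        positivity

section LorentzCone

variable {n : ℕ} [NeZero n]

theorem isOpen_lCone : IsOpen (lCone n) := by
  have h : Continuous (lDelta n) := by
    unfold lDelta
    fun_prop
  exact (isOpen_lt continuous_const h).inter (isOpen_lt continuous_const (continuous_apply 0))

/-- The base point of the cone. -/
def lOne (n : ℕ) [NeZero n] : Fin n → ℝ :=
  Pi.single 0 1

/-- The Lorentz bilinear form. -/
def lForm (n : ℕ) [NeZero n] : LinearMap.BilinForm ℝ (Fin n → ℝ) :=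
  LinearMap.mk₂ ℝ (fun x y => 2 * (x 0 * y 0) - x ⬝ᵥ y)
    (fun x y z => by simp only [Pi.add_apply, add_dotProduct]; ring)
    (fun c x y => by simp only [Pi.smul_apply, smul_dotProduct, smul_eq_mul]; ring)
    (fun x y z => by simp only [Pi.add_apply, dotProduct_add]; ring)
    (fun c x y => by simp only [Pi.smul_apply, dotProduct_smul, smul_eq_mul]; ring)

theorem lForm_apply (x y : Fin n → ℝ) : lForm n x y = 2 * (x 0 * y 0) - x ⬝ᵥ y := rfl

theorem lForm_self (x : Fin n → ℝ) : lForm n x x = lDelta n x := by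
  simp [lForm_apply, lDelta, dotProduct, sq]

theorem lForm_comm (x y : Fin n → ℝ) : lForm n x y = lForm n y x := by
  rw [lForm_apply, lForm_apply, dotProduct_comm, mul_comm (x 0)]

theorem lForm_lOne (y : Fin n → ℝ) : lForm n (lOne n) y = y 0 := by
  simp [lForm_apply, lOne]
  ring

theorem lOne_mem_lCone : lOne n ∈ lCone n := by
  have h : lDelta n (lOne n) = 1 := by rw [← lForm_self, lForm_lOne]; simp [lOne]
  exact ⟨h ▸ one_pos, by simp [lOne]⟩

theorem lForm_pos {x y : Fin n → ℝ} (hx : x ∈ lCone n) (hy : y ∈ lCone n) :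
    0 < lForm n x y := by
  have h : lForm n (y 0 • x - x 0 • y) (y 0 • x - x 0 • y) ≤ 0 := by
    rw [lForm_apply]
    have : (y 0 • x - x 0 • y) 0 = 0 := by simp [mul_comm]
    rw [this]
    have h := dotProduct_self_star_nonneg (y 0 • x - x 0 • y)
    simp only [star_trivial] at h
    linarith
  simp only [map_sub, map_smul, LinearMap.sub_apply, LinearMap.smul_apply, smul_eq_mul,
    lForm_self, lForm_comm y x] at h
  obtain ⟨hx, hx0⟩ := hx
  obtain ⟨hy, hy0⟩ := hy
  have h₁ : 0 < y 0 * (y 0 * lDelta n x) := by positivity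
  have h₂ : 0 < x 0 * (x 0 * lDelta n y) := by positivity
  have h₃ : 0 < x 0 * y 0 * lForm n x y := by nlinarith
  exact pos_of_mul_pos_right h₃ (by positivity)

theorem add_mem_lCone {x y : Fin n → ℝ} (hx : x ∈ lCone n) (hy : y ∈ lCone n) :
    x + y ∈ lCone n := by
  refine ⟨?_, add_pos hx.2 hy.2⟩
  have := lForm_pos hx hy
  rw [← lForm_self]
  simp only [map_add, LinearMap.add_apply, lForm_self, lForm_comm y x]
  linarith [hx.1, hy.1]

/-- The norm `√Δ(v)` of a point of the cone. -/
def lNorm (v : Fin n → ℝ) : ℝ :=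
  √(lDelta n v)

/-- A linear similarity of the Lorentz form carrying the base point to `v`: the negative of the
reflection along `√Δ(v) e + v`, scaled by `√Δ(v)`. -/
def lMove (v : Fin n → ℝ) : (Fin n → ℝ) →ₗ[ℝ] (Fin n → ℝ) :=
  (lNorm v + v 0)⁻¹ • (lForm n (lNorm v • lOne n + v)).smulRight (lNorm v • lOne n + v) -
    lNorm v • LinearMap.id

theorem lMove_apply (v y : Fin n → ℝ) :
    lMove v y = ((lNorm v + v 0)⁻¹ * (lNorm v * y 0 + lForm n v y)) • (lNorm v • lOne n + v) -
      lNorm v • y := by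
  simp [lMove, lForm_lOne, mul_smul]

theorem lNorm_pos {v : Fin n → ℝ} (hv : v ∈ lCone n) : 0 < lNorm v :=
  Real.sqrt_pos.2 hv.1

theorem lNorm_sq {v : Fin n → ℝ} (hv : v ∈ lCone n) : lNorm v ^ 2 = lDelta n v :=
  Real.sq_sqrt hv.1.le

theorem lNorm_add_pos {v : Fin n → ℝ} (hv : v ∈ lCone n) : 0 < lNorm v + v 0 :=
  add_pos (lNorm_pos hv) hv.2

theorem lMove_apply_zero {v : Fin n → ℝ} (hv : v ∈ lCone n) (y : Fin n → ℝ) :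
    lMove v y 0 = lForm n v y := by
  have := (lNorm_add_pos hv).ne'
  have h : lOne n 0 = 1 := by simp [lOne]
  simp only [lMove_apply, Pi.sub_apply, Pi.smul_apply, Pi.add_apply, smul_eq_mul, h]
  field_simp
  ring

theorem lForm_lMove {v : Fin n → ℝ} (hv : v ∈ lCone n) (y : Fin n → ℝ) :
    lForm n v (lMove v y) = lDelta n v * y 0 := by
  have := (lNorm_add_pos hv).ne'
  have h := lNorm_sq hv
  simp only [lMove_apply, map_sub, map_smul, map_add, smul_eq_mul, lForm_comm v (lOne n),
    lForm_lOne, lForm_self]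
  rw [← h]
  field_simp
  ring

theorem lDelta_lMove {v : Fin n → ℝ} (hv : v ∈ lCone n) (y : Fin n → ℝ) :
    lDelta n (lMove v y) = lDelta n v * lDelta n y := by
  have := (lNorm_add_pos hv).ne'
  have h := lNorm_sq hv
  have h1 : lDelta n (lOne n) = 1 := by rw [← lForm_self, lForm_lOne]; simp [lOne]
  rw [← lForm_self]
  simp only [lMove_apply, map_sub, map_smul, map_add, smul_eq_mul, LinearMap.sub_apply,
    LinearMap.add_apply, LinearMap.smul_apply, lForm_comm v (lOne n),
    lForm_comm y, lForm_lOne, lForm_self, h1]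
  rw [← h]
  field_simp
  ring

theorem lMove_lMove {v : Fin n → ℝ} (hv : v ∈ lCone n) (y : Fin n → ℝ) :
    lMove v (lMove v y) = lDelta n v • y := by
  have := (lNorm_add_pos hv).ne'
  have h := lNorm_sq hv
  rw [lMove_apply v (lMove v y), lMove_apply_zero hv, lForm_lMove hv, lMove_apply, ← h]
  ext i
  simp only [Pi.sub_apply, Pi.smul_apply, Pi.add_apply, smul_eq_mul]
  field_simp
  ring

theorem lMove_lOne {v : Fin n → ℝ} (hv : v ∈ lCone n) : lMove v (lOne n) = v := by
  have := (lNorm_add_pos hv).ne'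
  have h : lOne n 0 = 1 := by simp [lOne]
  rw [lMove_apply, lForm_comm, lForm_lOne, h]
  ext i
  simp only [Pi.sub_apply, Pi.smul_apply, Pi.add_apply, smul_eq_mul]
  field_simp
  ring

theorem lMove_mem {v : Fin n → ℝ} (hv : v ∈ lCone n) {y : Fin n → ℝ} (hy : y ∈ lCone n) :
    lMove v y ∈ lCone n :=
  ⟨by rw [lDelta_lMove hv]; exact mul_pos hv.1 hy.1,
    by rw [lMove_apply_zero hv]; exact lForm_pos hv hy⟩

theorem injective_lMove {v : Fin n → ℝ} (hv : v ∈ lCone n) :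
    Function.Injective (lMove v) := fun x y h => by
  have h := congrArg (lMove v) h
  rw [lMove_lMove hv, lMove_lMove hv] at h
  exact smul_right_injective _ hv.1.ne' h

theorem image_lMove {v : Fin n → ℝ} (hv : v ∈ lCone n) : lMove v '' lCone n = lCone n := by
  refine Set.Subset.antisymm (Set.image_subset_iff.2 fun y hy => lMove_mem hv hy) fun y hy => ?_
  have hc := inv_pos.2 hv.1
  refine ⟨(lDelta n v)⁻¹ • lMove v y, ?_, ?_⟩
  · have h := lMove_mem hv hy
    refine ⟨?_, mul_pos hc h.2⟩
    rw [← lForm_self]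
    simp only [map_smul, LinearMap.smul_apply, smul_eq_mul, lForm_self]
    exact mul_pos hc (mul_pos hc h.1)
  · rw [map_smul, lMove_lMove hv, inv_smul_smul₀ hv.1.ne']

theorem abs_det_lMove {v : Fin n → ℝ} (hv : v ∈ lCone n) :
    |LinearMap.det (lMove v)| = lDelta n v ^ ((n : ℝ) / 2) := by
  have h : lMove v ∘ₗ lMove v = lDelta n v • LinearMap.id := LinearMap.ext (lMove_lMove hv)
  have h := congrArg LinearMap.det h
  rw [LinearMap.det_comp, LinearMap.det_smul, LinearMap.det_id, Module.finrank_fin_fun,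
    mul_one, ← sq] at h
  have hp : 0 ≤ lDelta n v := hv.1.le
  rw [← Real.sqrt_sq_eq_abs, h, Real.sqrt_eq_rpow, ← Real.rpow_natCast, ← Real.rpow_mul hp,
    mul_one_div]

theorem lIntegrand_lMove {v : Fin n → ℝ} (hv : v ∈ lCone n) (s t : ℝ)
    {y : Fin n → ℝ} (hy : y ∈ lCone n) :
    |LinearMap.det (lMove v)| •
        (lDelta n (lMove v y + v) ^ s * lDelta n (lMove v y) ^ (t - (n : ℝ) / 2)) =
      lDelta n v ^ (s + t) *
        (lDelta n (y + lOne n) ^ s * lDelta n y ^ (t - (n : ℝ) / 2)) := by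
  have h : lMove v y + v = lMove v (y + lOne n) := by rw [map_add, lMove_lOne hv]
  rw [h, lDelta_lMove hv, lDelta_lMove hv, abs_det_lMove hv, smul_eq_mul,
    Real.mul_rpow hv.1.le (add_mem_lCone hy lOne_mem_lCone).1.le, Real.mul_rpow hv.1.le hy.1.le]
  have e : s + t = n / 2 + s + (t - n / 2) := by ring
  rw [e, Real.rpow_add hv.1, Real.rpow_add hv.1]
  ring

theorem hasFDerivWithinAt_lMove (v y : Fin n → ℝ) (A : Set (Fin n → ℝ)) :
    HasFDerivWithinAt (lMove v) (LinearMap.toContinuousLinearMap (lMove v)) A y :=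
  (LinearMap.toContinuousLinearMap (lMove v)).hasFDerivWithinAt

theorem lDelta_eq_sub_norm_sq {m : ℕ} (y : Fin (m + 1) → ℝ) :
    lDelta (m + 1) y = y 0 ^ 2 - ‖WithLp.toLp 2 (Fin.tail y)‖ ^ 2 := by
  simp only [lDelta, Fin.sum_univ_succ, EuclideanSpace.norm_sq_eq, Fin.tail, Real.norm_eq_abs,
    sq_abs]
  ring

theorem measurePreserving_cons_toLp (m : ℕ) :
    MeasurePreserving (fun y : Fin (m + 1) → ℝ => (y 0, WithLp.toLp 2 (Fin.tail y))) :=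
  ((MeasurePreserving.id volume).prod (PiLp.volume_preserving_toLp (Fin m))).comp
    (volume_preserving_piFinSuccAbove (fun _ : Fin (m + 1) => ℝ) 0)

theorem integrableOn_lOne (hn : 3 ≤ n) (s t : ℝ)
    (ht : t > (n : ℝ) / 2 - 1) (hst : s + t < 1 - (n : ℝ) / 2) :
    IntegrableOn (fun y => lDelta n (y + lOne n) ^ s * lDelta n y ^ (t - (n : ℝ) / 2))
      (lCone n) := by
  obtain ⟨m, rfl⟩ : ∃ m, n = m + 2 := ⟨n - 2, by omega⟩
  have h := integrable_prod_fun_norm (E := EuclideanSpace ℝ (Fin (m + 1))) volume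
    (measurable_radialIntegrand s (t - ((m + 2 : ℕ) : ℝ) / 2)) (by
      rw [finrank_euclideanSpace_fin]
      refine integrable_pow_mul_radialIntegrand _ (by linarith) ?_
      push_cast at hst ⊢
      linarith)
  rw [← integrable_indicator_iff isOpen_lCone.measurableSet]
  refine ((measurePreserving_cons_toLp (m + 1)).integrable_comp h.aestronglyMeasurable).2 h
    |>.congr (.of_forall fun y => ?_)
  have htail : Fin.tail (y + lOne (m + 2)) = Fin.tail y := by
    ext i
    simp [Fin.tail, lOne]
  have hzero : (y + lOne (m + 2)) 0 = y 0 + 1 := by simp [lOne]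
  simp only [Function.comp_apply, radialIntegrand, Set.indicator_apply, radialCone, lCone,
    Set.mem_ofPred_eq, lDelta_eq_sub_norm_sq, htail, hzero]

end LorentzCone

/-- Lemma 3.1 of the paper (scalar exponents) on the rank-2 Lorentz cone:
for `t > n/2 − 1` and `s + t < 1 − n/2`, the integral
`∫_{Λ_n} Δ(y+v)^s Δ(y)^{t−n/2} dy` converges and equals `C_{s,t} Δ(v)^{s+t}`. -/
theorem statement7 (n : ℕ) [NeZero n] (hn : 3 ≤ n) (s t : ℝ)
    (ht : t > (n : ℝ) / 2 - 1) (hst : s + t < 1 - (n : ℝ) / 2) :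
    (∀ v ∈ lCone n,
      IntegrableOn (fun y => lDelta n (y + v) ^ s * lDelta n y ^ (t - (n : ℝ) / 2)) (lCone n)) ∧
    ∃ C > (0 : ℝ), ∀ v ∈ lCone n,
      (∫ y in lCone n, lDelta n (y + v) ^ s * lDelta n y ^ (t - (n : ℝ) / 2)) =
        C * lDelta n v ^ (s + t) := by
  have hI := integrableOn_lOne hn s t ht hst
  have hc : MeasurableSet (lCone n) := isOpen_lCone.measurableSet
  refine ⟨fun v hv => ?_, ∫ y in lCone n,
    lDelta n (y + lOne n) ^ s * lDelta n y ^ (t - (n : ℝ) / 2), ?_, fun v hv => ?_⟩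
  · rw [← image_lMove hv, integrableOn_image_iff_integrableOn_abs_det_fderiv_smul volume hc
      (fun y _ => hasFDerivWithinAt_lMove v y _) (injective_lMove hv).injOn]
    exact (integrableOn_congr_fun (fun y hy => lIntegrand_lMove hv s t hy) hc).2
      (hI.const_mul _)
  · have hpos : ∀ y ∈ lCone n,
        0 < lDelta n (y + lOne n) ^ s * lDelta n y ^ (t - (n : ℝ) / 2) := fun y hy =>
      mul_pos (Real.rpow_pos_of_pos (add_mem_lCone hy lOne_mem_lCone).1 _)
        (Real.rpow_pos_of_pos hy.1 _)
    rw [gt_iff_lt, setIntegral_pos_iff_support_of_nonneg_ae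
      ((ae_restrict_mem hc).mono fun y hy => (hpos y hy).le) hI,
      Set.inter_eq_right.2 fun y hy => Function.mem_support.2 (hpos y hy).ne']
    exact isOpen_lCone.measure_pos volume ⟨_, lOne_mem_lCone⟩
  · conv_lhs => rw [← image_lMove hv]
    rw [integral_image_eq_integral_abs_det_fderiv_smul volume hc
      (fun y _ => hasFDerivWithinAt_lMove v y _) (injective_lMove hv).injOn, mul_comm,
      ← integral_const_mul]
    exact setIntegral_congr_fun hc fun y hy => lIntegrand_lMove hv s t hy
end
end

section
/- Let n ≥ 3, let α, β, γ, ν, μ be real numbers and 1 < p ≤ q < ∞. Assume ν/p′ + μ/q > 0 and that the parameters satisfy: (i) γ = α + β + n/2 − ν/p + μ/q; (ii) p(β − γ + n − 1) − n/2 + 1 < ν < p(β + 1) + n/2 − 1; (iii) n/2 − 1 − qα < μ < q(γ − α) − n/2 + 1. Then the operator S = S_{α,β,γ} is bounded from L^p_ν(Λ_n) into L^q_μ(Λ_n). (This is the sufficiency lemma, Lemma 4.1 of the paper, instantiated on the rank-2 Lorentz cone, where n/r = n/2 and 2(n/r) − 1 = n − 1.) -/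
open MeasureTheory ENNReal

noncomputable section

/-- The `L^p_ν(Λ_n)` norm `(∫_{Λ_n} |g(y)|^p Δ(y)^{ν−n/2} dy)^{1/p}`. -/
def coneNorm (n : ℕ) [NeZero n] (p ν : ℝ) (g : (Fin n → ℝ) → ℝ) : ℝ≥0∞ :=
  (∫⁻ y in lCone n, ENNReal.ofReal (|g y| ^ p * lDelta n y ^ (ν - (n : ℝ) / 2))) ^ (1 / p)

/-- The operator `S_{α,β,γ}` applied to `|g|`:
`S|g|(y) = Δ(y)^α ∫_{Λ_n} Δ(y+x)^{−γ} |g(x)| Δ(x)^β dx`. -/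
def Sop (n : ℕ) [NeZero n] (α β γ : ℝ) (g : (Fin n → ℝ) → ℝ) (y : Fin n → ℝ) : ℝ≥0∞ :=
  ENNReal.ofReal (lDelta n y ^ α) *
    ∫⁻ x in lCone n, ENNReal.ofReal (lDelta n (y + x) ^ (-γ) * |g x| * lDelta n x ^ β)

/-- The `L^q_μ(Λ_n)` norm of `S_{α,β,γ}|g|`. -/
def SopNorm (n : ℕ) [NeZero n] (α β γ q μ : ℝ) (g : (Fin n → ℝ) → ℝ) : ℝ≥0∞ :=
  (∫⁻ y in lCone n, Sop n α β γ g y ^ q * ENNReal.ofReal (lDelta n y ^ (μ - (n : ℝ) / 2))) ^ (1 / q)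

/-- `S_{α,β,γ}` is bounded from `L^p_ν(Λ_n)` to `L^q_μ(Λ_n)`:
`‖S|g|‖_{q,μ} ≤ C ‖g‖_{p,ν}` for every `g ∈ L^p_ν(Λ_n)`. -/
def SBounded (n : ℕ) [NeZero n] (α β γ p ν q μ : ℝ) : Prop :=
  ∃ C > (0 : ℝ), ∀ g : (Fin n → ℝ) → ℝ, Measurable g → coneNorm n p ν g < ⊤ →
    SopNorm n α β γ q μ g ≤ ENNReal.ofReal C * coneNorm n p ν g

/-- Euclidean square norm. -/
def sqSum {m : ℕ} (w : Fin m → ℝ) : ℝ := ∑ i, w i ^ 2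

lemma sqSum_nonneg {m : ℕ} (w : Fin m → ℝ) : 0 ≤ sqSum w :=
  Finset.sum_nonneg fun _ _ => sq_nonneg _

lemma measurable_sqSum {m : ℕ} : Measurable (sqSum : (Fin m → ℝ) → ℝ) := by
  unfold sqSum
  fun_prop

lemma norm_sq_le_sqSum {m : ℕ} (w : Fin m → ℝ) : ‖w‖ ^ 2 ≤ sqSum w := by
  have h : ‖w‖ ≤ √(sqSum w) := by
    refine (pi_norm_le_iff_of_nonneg (Real.sqrt_nonneg _)).2 fun i => ?_
    refine Real.le_sqrt_of_sq_le ?_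
    rw [Real.norm_eq_abs, sq_abs]
    exact Finset.single_le_sum (f := fun i => w i ^ 2) (fun _ _ => sq_nonneg _)
      (Finset.mem_univ i)
  calc ‖w‖ ^ 2 ≤ √(sqSum w) ^ 2 := by gcongr
    _ = sqSum w := Real.sq_sqrt (sqSum_nonneg w)

lemma lintegral_comp_smul_pi {m : ℕ} {f : (Fin m → ℝ) → ℝ≥0∞} (hf : Measurable f) {r : ℝ}
    (hr : 0 < r) : ∫⁻ w, f (r • w) = ENNReal.ofReal ((r ^ m)⁻¹) * ∫⁻ w, f w := by
  have h := Measure.map_addHaar_smul (volume : Measure (Fin m → ℝ)) hr.ne'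
  rw [← lintegral_map hf (measurable_const_smul r), h, lintegral_smul_measure,
    Module.finrank_fin_fun, abs_of_pos (by positivity), smul_eq_mul]

lemma exists_lintegral_bracket_le (m : ℕ) {σ : ℝ} (hσ : (m : ℝ) / 2 < σ) :
    ∃ C : ℝ≥0∞, C ≠ ⊤ ∧ ∀ P c : ℝ, 0 < P → 0 < c → ∀ w₀ : Fin m → ℝ,
      ∫⁻ w, ENNReal.ofReal ((P + c * sqSum (w - w₀)) ^ (-σ)) ≤
        C * ENNReal.ofReal (P ^ ((m : ℝ) / 2 - σ) * c ^ (-((m : ℝ) / 2))) := by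
  have hσ0 : 0 < σ := lt_of_le_of_lt (by positivity) hσ
  have hmeas : Measurable fun w : Fin m → ℝ => ENNReal.ofReal ((1 + sqSum w) ^ (-σ)) := by
    have := measurable_sqSum (m := m)
    fun_prop
  refine ⟨∫⁻ w : Fin m → ℝ, ENNReal.ofReal ((1 + sqSum w) ^ (-σ)), ?_, fun P c hP hc w₀ => ?_⟩
  · have hi : Integrable (fun w : Fin m → ℝ => ((1 : ℝ) + ‖w‖ ^ 2) ^ (-(2 * σ) / 2)) :=
      integrable_rpow_neg_one_add_norm_sq (by rw [Module.finrank_fin_fun]; linarith)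
    refine (lt_of_le_of_lt (lintegral_mono fun w => ?_) hi.lintegral_lt_top).ne
    refine ENNReal.ofReal_le_ofReal ?_
    rw [show -(2 * σ) / 2 = -σ by ring]
    exact Real.rpow_le_rpow_of_nonpos (by positivity)
      (by linarith [norm_sq_le_sqSum w]) (by linarith)
  · set r := √(c / P) with hr
    have hr0 : 0 < r := Real.sqrt_pos.2 (by positivity)
    have hr2 : r ^ 2 = c / P := Real.sq_sqrt (by positivity)
    have hs (w : Fin m → ℝ) : P + c * sqSum w = P * (1 + sqSum (r • w)) := by
      have : sqSum (r • w) = r ^ 2 * sqSum w := by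
        simp [sqSum, mul_pow, Finset.mul_sum]
      rw [this, hr2]
      field_simp
    calc ∫⁻ w, ENNReal.ofReal ((P + c * sqSum (w - w₀)) ^ (-σ))
        = ∫⁻ w, ENNReal.ofReal ((P + c * sqSum w) ^ (-σ)) :=
          lintegral_sub_right_eq_self (fun w => ENNReal.ofReal ((P + c * sqSum w) ^ (-σ))) w₀
      _ = ∫⁻ w, ENNReal.ofReal (P ^ (-σ)) * ENNReal.ofReal ((1 + sqSum (r • w)) ^ (-σ)) := by
          refine lintegral_congr fun w => ?_
          rw [hs, Real.mul_rpow hP.le (by linarith [sqSum_nonneg (r • w)]),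
            ENNReal.ofReal_mul (by positivity)]
      _ = ENNReal.ofReal (P ^ (-σ)) * (ENNReal.ofReal ((r ^ m)⁻¹) *
            ∫⁻ w : Fin m → ℝ, ENNReal.ofReal ((1 + sqSum w) ^ (-σ))) := by
          rw [lintegral_const_mul' _ _ ENNReal.ofReal_ne_top, lintegral_comp_smul_pi hmeas hr0]
      _ ≤ _ := by
          rw [← mul_assoc, ← ENNReal.ofReal_mul (by positivity), mul_comm]
          refine le_of_eq ?_
          congr 2
          have : r ^ m = (c / P) ^ ((m : ℝ) / 2) := by
            rw [← Real.rpow_natCast, hr, Real.sqrt_eq_rpow, ← Real.rpow_mul (by positivity)]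
            congr 1; ring
          rw [this, Real.div_rpow hc.le hP.le, Real.rpow_neg hc.le, sub_eq_add_neg,
            Real.rpow_add hP]
          field_simp

lemma lintegral_Ioi_rpow_mul_add_rpow_le {A B : ℝ} (hA : 0 < A) (hAB : A < B) {U : ℝ}
    (hU : 0 < U) :
    ∫⁻ u in Set.Ioi (0 : ℝ), ENNReal.ofReal (u ^ (A - 1) * (u + U) ^ (-B)) ≤
      ENNReal.ofReal (1 / A + 1 / (B - A)) * ENNReal.ofReal (U ^ (A - B)) := by
  have hBA : 0 < B - A := by linarith
  have hU1 : ∫⁻ u in Set.Ioc 0 U, ENNReal.ofReal (u ^ (A - 1)) = ENNReal.ofReal (U ^ A / A) := by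
    have hi : IntervalIntegrable (fun x : ℝ => x ^ (A - 1)) volume 0 U :=
      intervalIntegral.intervalIntegrable_rpow' (by linarith)
    rw [← ofReal_integral_eq_lintegral_ofReal
      ((intervalIntegrable_iff_integrableOn_Ioc_of_le hU.le).1 hi),
      ← intervalIntegral.integral_of_le hU.le, integral_rpow (Or.inl (by linarith))]
    · rw [sub_add_cancel, Real.zero_rpow hA.ne', sub_zero]
    · filter_upwards [ae_restrict_mem measurableSet_Ioc] with u hu
      exact Real.rpow_nonneg hu.1.le _
  have hU2 : ∫⁻ u in Set.Ioi U, ENNReal.ofReal (u ^ (A - 1 - B)) =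
      ENNReal.ofReal (U ^ (A - B) / (B - A)) := by
    rw [← ofReal_integral_eq_lintegral_ofReal
      (integrableOn_Ioi_rpow_of_lt (by linarith) hU),
      integral_Ioi_rpow_of_lt (by linarith) hU]
    · congr 1
      rw [show A - 1 - B + 1 = -(B - A) by ring, show A - B = -(B - A) by ring, div_neg, neg_div,
        neg_neg]
    · filter_upwards [ae_restrict_mem measurableSet_Ioi] with u hu
      exact Real.rpow_nonneg (hU.trans hu).le _
  rw [← Set.Ioc_union_Ioi_eq_Ioi hU.le, lintegral_union measurableSet_Ioi
    (Set.Ioc_disjoint_Ioi le_rfl)]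
  have h1 : ∫⁻ u in Set.Ioc 0 U, ENNReal.ofReal (u ^ (A - 1) * (u + U) ^ (-B)) ≤
      ENNReal.ofReal (U ^ (-B)) * ENNReal.ofReal (U ^ A / A) := by
    rw [← hU1, ← lintegral_const_mul' _ _ ENNReal.ofReal_ne_top]
    refine setLIntegral_mono' measurableSet_Ioc fun u hu => ?_
    rw [← ENNReal.ofReal_mul (by positivity), mul_comm]
    refine ENNReal.ofReal_le_ofReal ?_
    have := hu.1
    have h2 := Real.rpow_le_rpow_of_nonpos hU (by linarith : U ≤ u + U) (by linarith : -B ≤ 0)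
    gcongr
  have h2 : ∫⁻ u in Set.Ioi U, ENNReal.ofReal (u ^ (A - 1) * (u + U) ^ (-B)) ≤
      ENNReal.ofReal (U ^ (A - B) / (B - A)) := by
    rw [← hU2]
    refine setLIntegral_mono' measurableSet_Ioi fun u hu => ?_
    have hu0 : 0 < u := hU.trans hu
    refine ENNReal.ofReal_le_ofReal ?_
    rw [sub_eq_add_neg (A - 1) B, Real.rpow_add hu0]
    have h2 := Real.rpow_le_rpow_of_nonpos hu0 (by linarith : u ≤ u + U) (by linarith : -B ≤ 0)
    gcongr
  refine (add_le_add h1 h2).trans (le_of_eq ?_)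
  rw [← ENNReal.ofReal_mul (by positivity), ← ENNReal.ofReal_mul (by positivity),
    ← ENNReal.ofReal_add (by positivity) (by positivity)]
  congr 1
  rw [sub_eq_add_neg A B, Real.rpow_add hU]
  field_simp

lemma lintegral_fin_cons {k : ℕ} {G : (Fin (k + 1) → ℝ) → ℝ≥0∞} (hG : Measurable G) :
    ∫⁻ x, G x = ∫⁻ a : ℝ, ∫⁻ r : Fin k → ℝ, G (Fin.cons a r) := by
  have h := (volume_preserving_piFinSuccAbove (fun _ : Fin (k + 1) => ℝ) 0).symm
  rw [← h.lintegral_comp hG, Measure.volume_eq_prod, lintegral_prod]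
  · simp [Fin.consEquiv]
  · exact (hG.comp (MeasurableEquiv.measurable _)).aemeasurable

lemma lintegral_comp_affine {g : ℝ → ℝ≥0∞} (hg : Measurable g) (c : ℝ) :
    ∫⁻ b, g (2 * b + c) = ENNReal.ofReal (1 / 2) * ∫⁻ d, g d := by
  have h1 : ∫⁻ b, g (2 * b + c) = ∫⁻ d, g (d + c) ∂(Measure.map (fun x : ℝ => 2 * x) volume) := by
    rw [lintegral_map (by fun_prop) (by fun_prop)]
  rw [h1, Real.map_volume_mul_left two_ne_zero, lintegral_smul_measure,
    lintegral_add_right_eq_self g c]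
  norm_num

/-- The point of `ℝ^{m+2}` with coordinates `y₁ - y₂ = u`, `Δ(y) = u d` and tail `w`. -/
def conePt {m : ℕ} (u d : ℝ) (w : Fin m → ℝ) : Fin (m + 2) → ℝ :=
  Fin.cons (u + (d + (sqSum w / u - u)) / 2)
    (Fin.cons ((d + (sqSum w / u - u)) / 2) w)

lemma lDelta_cons {m : ℕ} (a b : ℝ) (w : Fin m → ℝ) :
    lDelta (m + 2) (Fin.cons a (Fin.cons b w)) = a ^ 2 - b ^ 2 - sqSum w := by
  simp [lDelta, Fin.sum_univ_succ, sqSum]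
  ring

lemma measurable_lDelta (n : ℕ) [NeZero n] : Measurable (lDelta n) := by
  unfold lDelta
  fun_prop

lemma measurableSet_lCone (n : ℕ) [NeZero n] : MeasurableSet (lCone n) :=
  (measurableSet_lt measurable_const (measurable_lDelta n)).inter
    (measurableSet_lt measurable_const (measurable_pi_apply 0))

lemma measurable_cons_cons {α : Type*} [MeasurableSpace α] {m : ℕ} {a b : α → ℝ}
    {w : α → Fin m → ℝ} (ha : Measurable a) (hb : Measurable b) (hw : Measurable w) :
    Measurable fun x => (Fin.cons (a x) (Fin.cons (b x) (w x)) : Fin (m + 2) → ℝ) := by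
  refine measurable_pi_iff.2 fun i => ?_
  refine Fin.cases ?_ (fun j => Fin.cases ?_ (fun k => ?_) j) i
  · simpa using ha
  · simpa using hb
  · exact (measurable_pi_apply k).comp hw

lemma lDelta_conePt {m : ℕ} {u : ℝ} (hu : u ≠ 0) (d : ℝ) (w : Fin m → ℝ) :
    lDelta (m + 2) (conePt u d w) = u * d := by
  rw [conePt, lDelta_cons]
  field_simp
  ring

lemma sub_pos_of_mem_lCone {m : ℕ} {y : Fin (m + 2) → ℝ} (hy : y ∈ lCone (m + 2)) :
    0 < y 0 - y 1 := by
  obtain ⟨h1, h2⟩ := hy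
  have h3 : y 1 ^ 2 < y 0 ^ 2 := by
    have h4 : y 0 ^ 2 + y 1 ^ 2 ≤ ∑ i, y i ^ 2 := by
      rw [Fin.sum_univ_succ, Fin.sum_univ_succ]
      have := sqSum_nonneg fun i : Fin m => y i.succ.succ
      unfold sqSum at this
      simp only [Fin.succ_zero_eq_one]
      linarith
    unfold lDelta at h1
    linarith
  have := abs_lt_of_sq_lt_sq h3 h2.le
  linarith [(abs_lt.1 this).2, le_abs_self (y 1)]

lemma lintegral_lCone_le {m : ℕ} {F : (Fin (m + 2) → ℝ) → ℝ≥0∞} (hF : Measurable F) :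
    ∫⁻ x in lCone (m + 2), F x ≤
      ∫⁻ u in Set.Ioi (0 : ℝ), ∫⁻ d in Set.Ioi (0 : ℝ), ∫⁻ w : Fin m → ℝ, F (conePt u d w) := by
  set G := (lCone (m + 2)).indicator F with hGdef
  have hG : Measurable G := hF.indicator (measurableSet_lCone _)
  have hGu (u b : ℝ) (w : Fin m → ℝ) (hu : u ≤ 0) :
      G (Fin.cons (u + b) (Fin.cons b w)) = 0 := by
    refine Set.indicator_of_notMem (fun hy => ?_) _
    have := sub_pos_of_mem_lCone hy
    simp at this
    linarith
  have hshift (u : ℝ) (hu : 0 < u) (w : Fin m → ℝ) :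
      ∫⁻ b, G (Fin.cons (u + b) (Fin.cons b w)) ≤ ∫⁻ d in Set.Ioi (0 : ℝ), F (conePt u d w) := by
    have hm : Measurable fun d : ℝ => G (conePt u d w) :=
      hG.comp (measurable_cons_cons (by fun_prop) (by fun_prop) (by fun_prop))
    calc ∫⁻ b, G (Fin.cons (u + b) (Fin.cons b w))
        = ∫⁻ b, G (conePt u (2 * b + -(sqSum w / u - u)) w) := by
          refine lintegral_congr fun b => ?_
          rw [conePt]
          congr <;> ring
      _ = ENNReal.ofReal (1 / 2) * ∫⁻ d, G (conePt u d w) := lintegral_comp_affine hm _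
      _ ≤ ∫⁻ d, G (conePt u d w) := by
          refine mul_le_of_le_one_left' ?_
          rw [ENNReal.ofReal_le_one]
          norm_num
      _ ≤ ∫⁻ d, (Set.Ioi (0 : ℝ)).indicator (fun d => F (conePt u d w)) d := by
          refine lintegral_mono fun d => ?_
          rw [hGdef]
          by_cases h : conePt u d w ∈ lCone (m + 2)
          · have hd : d ∈ Set.Ioi (0 : ℝ) := by
              have := h.1
              rw [lDelta_conePt hu.ne'] at this
              exact pos_of_mul_pos_right this hu.le
            rw [Set.indicator_of_mem h, Set.indicator_of_mem hd]
          · rw [Set.indicator_of_notMem h]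
            exact zero_le
      _ = _ := lintegral_indicator measurableSet_Ioi _
  have hsub {X : Type} [MeasurableSpace X] {f : X → ℝ} {g : X → ℝ} {h : X → Fin m → ℝ}
      (hf : Measurable f) (hg : Measurable g) (hh : Measurable h) :
      Measurable fun x => G (Fin.cons (f x) (Fin.cons (g x) (h x))) :=
    hG.comp (measurable_cons_cons hf hg hh)
  calc ∫⁻ x in lCone (m + 2), F x = ∫⁻ x, G x :=
        (lintegral_indicator (measurableSet_lCone _) _).symm
    _ = ∫⁻ a : ℝ, ∫⁻ b : ℝ, ∫⁻ w : Fin m → ℝ, G (Fin.cons a (Fin.cons b w)) := by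
        rw [lintegral_fin_cons hG]
        refine lintegral_congr fun a => ?_
        rw [lintegral_fin_cons]
        refine hG.comp (measurable_pi_iff.2 fun i => Fin.cases ?_ (fun j => ?_) i)
        · simp
        · simpa using measurable_pi_apply j
    _ = ∫⁻ b : ℝ, ∫⁻ a : ℝ, ∫⁻ w : Fin m → ℝ, G (Fin.cons a (Fin.cons b w)) := by
        refine lintegral_lintegral_swap (Measurable.aemeasurable ?_)
        exact Measurable.lintegral_prod_right' (f := fun z : (ℝ × ℝ) × (Fin m → ℝ) =>
          G (Fin.cons z.1.1 (Fin.cons z.1.2 z.2))) (hsub (by fun_prop) (by fun_prop) (by fun_prop))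
    _ = ∫⁻ b : ℝ, ∫⁻ u : ℝ, ∫⁻ w : Fin m → ℝ, G (Fin.cons (u + b) (Fin.cons b w)) := by
        refine lintegral_congr fun b => ?_
        exact (lintegral_add_right_eq_self
          (fun a => ∫⁻ w : Fin m → ℝ, G (Fin.cons a (Fin.cons b w))) b).symm
    _ = ∫⁻ u : ℝ, ∫⁻ b : ℝ, ∫⁻ w : Fin m → ℝ, G (Fin.cons (u + b) (Fin.cons b w)) := by
        refine lintegral_lintegral_swap (Measurable.aemeasurable ?_)
        exact Measurable.lintegral_prod_right' (f := fun z : (ℝ × ℝ) × (Fin m → ℝ) =>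
          G (Fin.cons (z.1.2 + z.1.1) (Fin.cons z.1.1 z.2)))
          (hsub (by fun_prop) (by fun_prop) (by fun_prop))
    _ = ∫⁻ u : ℝ, ∫⁻ w : Fin m → ℝ, ∫⁻ b : ℝ, G (Fin.cons (u + b) (Fin.cons b w)) := by
        refine lintegral_congr fun u => ?_
        exact lintegral_lintegral_swap (Measurable.aemeasurable
          (hsub (by fun_prop) (by fun_prop) (by fun_prop)))
    _ ≤ ∫⁻ u : ℝ, (Set.Ioi (0 : ℝ)).indicator (fun u => ∫⁻ w : Fin m → ℝ,
          ∫⁻ d in Set.Ioi (0 : ℝ), F (conePt u d w)) u := by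
        refine lintegral_mono fun u => ?_
        by_cases hu : 0 < u
        · rw [Set.indicator_of_mem (show u ∈ Set.Ioi (0 : ℝ) from hu)]
          exact lintegral_mono (hshift u hu)
        · simp only [hGu u _ _ (not_lt.1 hu), lintegral_zero]
          exact zero_le
    _ = ∫⁻ u in Set.Ioi (0 : ℝ), ∫⁻ w : Fin m → ℝ, ∫⁻ d in Set.Ioi (0 : ℝ), F (conePt u d w) :=
        lintegral_indicator measurableSet_Ioi _
    _ = _ := by
        refine lintegral_congr fun u => ?_
        refine lintegral_lintegral_swap (Measurable.aemeasurable ?_)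
        have hQ : Measurable (sqSum : (Fin m → ℝ) → ℝ) := measurable_sqSum
        exact hF.comp (measurable_cons_cons (by fun_prop) (by fun_prop) (by fun_prop))

lemma exists_exp_eq {x : ℝ} (hx : 0 < x) : ∃ t : ℝ, Real.exp t = x :=
  ⟨Real.log x, Real.exp_log hx⟩

lemma conePt_zero_sub_one {m : ℕ} (u d : ℝ) (w : Fin m → ℝ) :
    conePt u d w 0 - conePt u d w 1 = u := by
  have h : conePt u d w 1 = (d + (sqSum w / u - u)) / 2 := rfl
  rw [h]
  simp [conePt]

lemma conePt_eta {m : ℕ} {y : Fin (m + 2) → ℝ} (hy : y 0 - y 1 ≠ 0) :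
    conePt (y 0 - y 1) (lDelta (m + 2) y / (y 0 - y 1)) (fun i => y i.succ.succ) = y := by
  have h : (Fin.cons (y 0) (Fin.cons (y 1) fun i => y i.succ.succ) : Fin (m + 2) → ℝ) = y := by
    funext i
    refine Fin.cases rfl (fun j => Fin.cases rfl (fun k => rfl) j) i
  have hΔ := lDelta_cons (y 0) (y 1) fun i => y i.succ.succ
  rw [h] at hΔ
  have hb : (lDelta (m + 2) y / (y 0 - y 1) +
      (sqSum (fun i => y i.succ.succ) / (y 0 - y 1) - (y 0 - y 1))) / 2 = y 1 := by
    rw [hΔ]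
    field_simp
    ring
  rw [conePt, hb, sub_add_cancel, h]

lemma lDelta_conePt_add {m : ℕ} {U u : ℝ} (hU : 0 < U) (hu : 0 < u) (E d : ℝ)
    (W w : Fin m → ℝ) :
    lDelta (m + 2) (conePt U E W + conePt u d w) =
      (u + U) * (d + E + U / (u * (u + U)) * sqSum (w - (u / U) • W)) := by
  have h : conePt U E W + conePt u d w =
      Fin.cons (U + (E + (sqSum W / U - U)) / 2 + (u + (d + (sqSum w / u - u)) / 2))
        (Fin.cons ((E + (sqSum W / U - U)) / 2 + (d + (sqSum w / u - u)) / 2) (W + w)) := by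
    funext i
    refine Fin.cases rfl (fun j => Fin.cases rfl (fun k => rfl) j) i
  have h1 : sqSum (W + w) = sqSum W + 2 * (∑ i, W i * w i) + sqSum w := by
    simp only [sqSum, Finset.mul_sum, ← Finset.sum_add_distrib, Pi.add_apply]
    exact Finset.sum_congr rfl fun i _ => by ring
  have h2 : sqSum (w - (u / U) • W) =
      sqSum w - 2 * (u / U) * (∑ i, W i * w i) + (u / U) ^ 2 * sqSum W := by
    simp only [sqSum, Finset.mul_sum, ← Finset.sum_add_distrib, ← Finset.sum_sub_distrib,
      Pi.sub_apply, Pi.smul_apply, smul_eq_mul]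
    exact Finset.sum_congr rfl fun i _ => by ring
  have hne : u + U ≠ 0 := by positivity
  rw [h, lDelta_cons, h1, h2]
  field_simp
  ring

/-- The generalized power `Δ₁^{t₁ - t₂} Δ^{t₂}`, with first principal minor `y₁ - y₂`. -/
def genPow (m : ℕ) (t₁ t₂ : ℝ) (y : Fin (m + 2) → ℝ) : ℝ :=
  (y 0 - y 1) ^ (t₁ - t₂) * lDelta (m + 2) y ^ t₂

lemma measurable_genPow (m : ℕ) (t₁ t₂ : ℝ) : Measurable (genPow m t₁ t₂) := by
  have := measurable_lDelta (m + 2)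
  unfold genPow
  fun_prop

lemma genPow_pos {m : ℕ} (t₁ t₂ : ℝ) {y : Fin (m + 2) → ℝ} (hy : y ∈ lCone (m + 2)) :
    0 < genPow m t₁ t₂ y :=
  mul_pos (Real.rpow_pos_of_pos (sub_pos_of_mem_lCone hy) _) (Real.rpow_pos_of_pos hy.1 _)

/-- The kernel of the operator `S` with respect to the invariant measure `Δ(x)^{-n/2} dx`. -/
def invKernel (m : ℕ) (A B : ℝ) (y x : Fin (m + 2) → ℝ) : ℝ :=
  lDelta (m + 2) y ^ A * lDelta (m + 2) x ^ B * lDelta (m + 2) (y + x) ^ (-(A + B))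

lemma exists_lintegral_invKernel_mul_genPow_le (m : ℕ) {A B t₁ t₂ : ℝ} (h1 : -B < t₁)
    (h2 : t₁ < A - (m : ℝ) / 2) (h3 : (m : ℝ) / 2 - B < t₂) (h4 : t₂ < A) :
    ∃ C : ℝ≥0∞, C ≠ ⊤ ∧ ∀ y ∈ lCone (m + 2),
      ∫⁻ x in lCone (m + 2), ENNReal.ofReal (invKernel m A B y x * genPow m t₁ t₂ x *
        lDelta (m + 2) x ^ (-((m : ℝ) / 2 + 1))) ≤ C * ENNReal.ofReal (genPow m t₁ t₂ y) := by
  set κ := (m : ℝ) / 2 with hκ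
  obtain ⟨C, hC, hw⟩ := exists_lintegral_bracket_le m (σ := A + B) (by linarith)
  set C₁ := ENNReal.ofReal (1 / (B + t₁) + 1 / (A + B - κ - (B + t₁)))
  set C₂ := ENNReal.ofReal (1 / (B + t₂ - κ) + 1 / (A + B - κ - (B + t₂ - κ)))
  refine ⟨C * C₁ * C₂, by finiteness, fun y hy => ?_⟩
  have hU := sub_pos_of_mem_lCone hy
  have hE : 0 < lDelta (m + 2) y / (y 0 - y 1) := div_pos hy.1 hU
  have hyeta := conePt_eta hU.ne'
  generalize y 0 - y 1 = U at hU hE hyeta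
  generalize lDelta (m + 2) y / U = E at hE hyeta
  generalize (fun i : Fin m => y i.succ.succ) = W at hyeta
  subst hyeta
  have hΔ := measurable_lDelta (m + 2)
  have hg := measurable_genPow m t₁ t₂
  refine (lintegral_lCone_le ?_).trans ?_
  · unfold invKernel
    fun_prop
  have inner (u d : ℝ) (hu : 0 < u) (hd : 0 < d) :
      ∫⁻ w : Fin m → ℝ, ENNReal.ofReal (invKernel m A B (conePt U E W) (conePt u d w) *
        genPow m t₁ t₂ (conePt u d w) * lDelta (m + 2) (conePt u d w) ^ (-(κ + 1))) ≤
      C * ENNReal.ofReal (U ^ (A - κ) * E ^ A) *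
        ENNReal.ofReal (u ^ (B + t₁ - 1) * (u + U) ^ (-(A + B - κ))) *
        ENNReal.ofReal (d ^ (B + t₂ - κ - 1) * (d + E) ^ (-(A + B - κ))) := by
    set X : ℝ := (U * E) ^ A * (u * d) ^ B * (u + U) ^ (-(A + B)) *
      (u ^ (t₁ - t₂) * (u * d) ^ t₂) * (u * d) ^ (-(κ + 1)) with hX
    calc _ = ∫⁻ w : Fin m → ℝ, ENNReal.ofReal X * ENNReal.ofReal
          ((d + E + U / (u * (u + U)) * sqSum (w - (u / U) • W)) ^ (-(A + B))) := by
          refine lintegral_congr fun w => ?_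
          rw [invKernel, genPow, conePt_zero_sub_one, lDelta_conePt_add hU hu,
            lDelta_conePt hU.ne', lDelta_conePt hu.ne', ← ENNReal.ofReal_mul (by positivity),
            Real.mul_rpow (x := u + U) (by positivity)
              (by have := sqSum_nonneg (w - (u / U) • W); positivity), hX]
          congr 1
          ring
      _ ≤ ENNReal.ofReal X * (C * ENNReal.ofReal ((d + E) ^ (κ - (A + B)) *
            (U / (u * (u + U))) ^ (-κ))) := by
          rw [lintegral_const_mul' _ _ ENNReal.ofReal_ne_top]
          gcongr
          exact hw _ _ (by positivity) (by positivity) _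
      _ = _ := by
          rw [mul_left_comm, ← ENNReal.ofReal_mul (by positivity), mul_assoc C, mul_assoc C,
            ← ENNReal.ofReal_mul (by positivity), ← ENNReal.ofReal_mul (by positivity)]
          congr 2
          have hs : 0 < u + U := by positivity
          have hs' : 0 < d + E := by positivity
          rw [hX]
          clear hX X hw
          generalize u + U = s at hs
          generalize d + E = s' at hs'
          obtain ⟨u, rfl⟩ := exists_exp_eq hu
          obtain ⟨d, rfl⟩ := exists_exp_eq hd
          obtain ⟨U, rfl⟩ := exists_exp_eq hU
          obtain ⟨E, rfl⟩ := exists_exp_eq hE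
          obtain ⟨s, rfl⟩ := exists_exp_eq hs
          obtain ⟨s', rfl⟩ := exists_exp_eq hs'
          simp only [← Real.exp_add, ← Real.exp_mul, ← Real.exp_sub]
          congr 1
          ring
  calc _ ≤ ∫⁻ u in Set.Ioi (0 : ℝ), ∫⁻ d in Set.Ioi (0 : ℝ),
        C * ENNReal.ofReal (U ^ (A - κ) * E ^ A) *
        ENNReal.ofReal (u ^ (B + t₁ - 1) * (u + U) ^ (-(A + B - κ))) *
        ENNReal.ofReal (d ^ (B + t₂ - κ - 1) * (d + E) ^ (-(A + B - κ))) :=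
        setLIntegral_mono' measurableSet_Ioi fun u hu =>
          setLIntegral_mono' measurableSet_Ioi fun d hd => inner u d hu hd
    _ ≤ ∫⁻ u in Set.Ioi (0 : ℝ), C * ENNReal.ofReal (U ^ (A - κ) * E ^ A) *
        ENNReal.ofReal (u ^ (B + t₁ - 1) * (u + U) ^ (-(A + B - κ))) *
          (C₂ * ENNReal.ofReal (E ^ (B + t₂ - κ - (A + B - κ)))) := by
        refine lintegral_mono fun u => ?_
        rw [lintegral_const_mul' _ _ (by finiteness)]
        gcongr
        exact lintegral_Ioi_rpow_mul_add_rpow_le (by linarith) (by linarith) hE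
    _ ≤ C * ENNReal.ofReal (U ^ (A - κ) * E ^ A) *
          (C₁ * ENNReal.ofReal (U ^ (B + t₁ - (A + B - κ)))) *
          (C₂ * ENNReal.ofReal (E ^ (B + t₂ - κ - (A + B - κ)))) := by
        rw [lintegral_mul_const' _ _ (by finiteness), lintegral_const_mul' _ _ (by finiteness)]
        gcongr
        exact lintegral_Ioi_rpow_mul_add_rpow_le (by linarith) (by linarith) hU
    _ = C * C₁ * C₂ * (ENNReal.ofReal (U ^ (A - κ) * E ^ A) *
          (ENNReal.ofReal (U ^ (B + t₁ - (A + B - κ))) *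
          ENNReal.ofReal (E ^ (B + t₂ - κ - (A + B - κ))))) := by ring
    _ = _ := by
        rw [← ENNReal.ofReal_mul (by positivity), ← ENNReal.ofReal_mul (by positivity),
          genPow, conePt_zero_sub_one, lDelta_conePt hU.ne']
        congr 2
        obtain ⟨U, rfl⟩ := exists_exp_eq hU
        obtain ⟨E, rfl⟩ := exists_exp_eq hE
        simp only [← Real.exp_add, ← Real.exp_mul]
        congr 1
        ring

lemma lDelta_add_pos {m : ℕ} {y x : Fin (m + 2) → ℝ} (hy : y ∈ lCone (m + 2))
    (hx : x ∈ lCone (m + 2)) : 0 < lDelta (m + 2) (y + x) := by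
  have hU := sub_pos_of_mem_lCone hy
  have hu := sub_pos_of_mem_lCone hx
  have hE := div_pos hy.1 hU
  have hd := div_pos hx.1 hu
  rw [← conePt_eta hU.ne', ← conePt_eta hu.ne', lDelta_conePt_add hU hu]
  have := sqSum_nonneg ((fun i : Fin m => x i.succ.succ) -
    ((x 0 - x 1) / (y 0 - y 1)) • fun i : Fin m => y i.succ.succ)
  positivity

lemma lintegral_rpow_le_of_factorization {X : Type*} [MeasurableSpace X] {ρ : Measure X}
    [SFinite ρ] {p q : ℝ} (hp : 1 < p) (hpq : p ≤ q) {f₁ f₂ : X → X → ℝ≥0∞} {f₃ : X → ℝ≥0∞}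
    (hf₁ : Measurable (Function.uncurry f₁)) (hf₂ : Measurable (Function.uncurry f₂))
    (hf₃ : Measurable f₃) {C₁ C₂ : ℝ≥0∞} (h₁ : ∀ᵐ y ∂ρ, ∫⁻ x, f₁ y x ∂ρ ≤ C₁)
    (h₂ : ∀ᵐ x ∂ρ, ∫⁻ y, f₂ y x ∂ρ ≤ C₂) :
    ∫⁻ y, (∫⁻ x, f₁ y x ^ (1 - 1 / p) * (f₂ y x * f₃ x) ^ (1 / q) *
        f₃ x ^ (1 / p - 1 / q) ∂ρ) ^ q ∂ρ ≤
      (C₁ ^ (1 - 1 / p)) ^ q * C₂ * (∫⁻ x, f₃ x ∂ρ) ^ (q / p) := by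
  have hp0 : 0 < p := by linarith
  have hq0 : 0 < q := by linarith
  have e1 : 0 ≤ 1 - 1 / p := by
    rw [sub_nonneg, div_le_one hp0]
    exact hp.le
  have e2 : 0 ≤ 1 / q := by positivity
  have e3 : 0 ≤ 1 / p - 1 / q := sub_nonneg.2 (one_div_le_one_div_of_le hp0 hpq)
  have e4 : 0 ≤ (1 / p - 1 / q) * q := by positivity
  set N := ∫⁻ x, f₃ x ∂ρ with hN
  have holder (y : X) : ∫⁻ x, f₁ y x ^ (1 - 1 / p) * (f₂ y x * f₃ x) ^ (1 / q) *
      f₃ x ^ (1 / p - 1 / q) ∂ρ ≤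
      (∫⁻ x, f₁ y x ∂ρ) ^ (1 - 1 / p) * (∫⁻ x, f₂ y x * f₃ x ∂ρ) ^ (1 / q) *
        N ^ (1 / p - 1 / q) := by
    have hm₁ : Measurable (f₁ y) := hf₁.comp (measurable_const.prodMk measurable_id)
    have hm₂ : Measurable (f₂ y) := hf₂.comp (measurable_const.prodMk measurable_id)
    have := ENNReal.lintegral_prod_norm_pow_le (μ := ρ) Finset.univ
      (f := ![f₁ y, fun x => f₂ y x * f₃ x, f₃]) (p := ![1 - 1 / p, 1 / q, 1 / p - 1 / q])
      (by
        intro i _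
        fin_cases i
        · exact hm₁.aemeasurable
        · exact (hm₂.mul hf₃).aemeasurable
        · exact hf₃.aemeasurable)
      (by simp [Fin.sum_univ_three])
      (by
        intro i _
        fin_cases i
        · exact e1
        · exact e2
        · exact e3)
    simpa [Fin.prod_univ_three] using this
  calc _ ≤ ∫⁻ y, ((C₁ ^ (1 - 1 / p)) ^ q * N ^ ((1 / p - 1 / q) * q)) *
        ∫⁻ x, f₂ y x * f₃ x ∂ρ ∂ρ := by
        refine lintegral_mono_ae ?_
        filter_upwards [h₁] with y hy
        calc _ ≤ (C₁ ^ (1 - 1 / p) * (∫⁻ x, f₂ y x * f₃ x ∂ρ) ^ (1 / q) *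
              N ^ (1 / p - 1 / q)) ^ q := by
              refine ENNReal.rpow_le_rpow ((holder y).trans ?_) hq0.le
              gcongr
          _ = _ := by
              rw [ENNReal.mul_rpow_of_nonneg _ _ hq0.le, ENNReal.mul_rpow_of_nonneg _ _ hq0.le,
                ← ENNReal.rpow_mul _ (1 / q), one_div_mul_cancel hq0.ne', ENNReal.rpow_one,
                ← ENNReal.rpow_mul N]
              ring
    _ = ((C₁ ^ (1 - 1 / p)) ^ q * N ^ ((1 / p - 1 / q) * q)) *
        ∫⁻ x, f₃ x * ∫⁻ y, f₂ y x ∂ρ ∂ρ := by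
        have hm : Measurable (Function.uncurry fun y x => f₂ y x * f₃ x) :=
          hf₂.mul (hf₃.comp measurable_snd)
        rw [lintegral_const_mul _ (f := fun y => ∫⁻ x, f₂ y x * f₃ x ∂ρ) hm.lintegral_prod_right',
          lintegral_lintegral_swap hm.aemeasurable]
        congr 1
        refine lintegral_congr fun x => ?_
        have hm₂ : Measurable fun y => f₂ y x :=
          hf₂.comp (measurable_id.prodMk measurable_const)
        rw [lintegral_mul_const _ hm₂, mul_comm]
    _ ≤ ((C₁ ^ (1 - 1 / p)) ^ q * N ^ ((1 / p - 1 / q) * q)) * (N * C₂) := by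
        gcongr
        rw [hN, ← lintegral_mul_const _ hf₃]
        refine lintegral_mono_ae ?_
        filter_upwards [h₂] with x hx
        gcongr
    _ = (C₁ ^ (1 - 1 / p)) ^ q * C₂ * (N ^ ((1 / p - 1 / q) * q) * N ^ (1 : ℝ)) := by
        rw [ENNReal.rpow_one]
        ring
    _ = _ := by
        rw [← ENNReal.rpow_add_of_nonneg _ _ e4 zero_le_one]
        congr 2
        field_simp
        ring

lemma exists_schur_exponents {A B a b : ℝ} (hA : 0 < A) (hB : 0 < B) (haA : A < a) (haB : B < a)
    (hbA : A < b) (hbB : B < b) :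
    ∃ u v t₁ t₂ : ℝ, u + v = 1 ∧ -(b * u) < t₁ ∧ t₁ < a * u - A ∧ A - b * u < t₂ ∧ t₂ < a * u ∧
      -(a * v) < t₁ ∧ t₁ < b * v - B ∧ B - a * v < t₂ ∧ t₂ < b * v := by
  obtain ⟨u, v, huv, hu, hv⟩ : ∃ u v : ℝ, u + v = 1 ∧ A < (a + b) * u ∧ B < (a + b) * v := by
    refine ⟨A / (A + B), B / (A + B), by field_simp, ?_, ?_⟩
    · rw [← mul_div_assoc, lt_div_iff₀ (by positivity), mul_comm]
      gcongr
    · rw [← mul_div_assoc, lt_div_iff₀ (by positivity), mul_comm]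
      gcongr
  have hau : a * u + a * v = a := by rw [← mul_add, huv, mul_one]
  have hbu : b * u + b * v = b := by rw [← mul_add, huv, mul_one]
  rw [add_mul] at hu hv
  obtain ⟨t₁, ht₁, ht₁'⟩ := exists_between
    (show max (-(b * u)) (-(a * v)) < min (a * u - A) (b * v - B) by
      refine max_lt (lt_min ?_ ?_) (lt_min ?_ ?_) <;> linarith)
  obtain ⟨t₂, ht₂, ht₂'⟩ := exists_between
    (show max (A - b * u) (B - a * v) < min (a * u) (b * v) by
      refine max_lt (lt_min ?_ ?_) (lt_min ?_ ?_) <;> linarith)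
  rw [max_lt_iff] at ht₁ ht₂
  rw [lt_min_iff] at ht₁' ht₂'
  exact ⟨u, v, t₁, t₂, huv, ht₁.1, ht₁'.1, ht₂.1, ht₂'.1, ht₁.2, ht₁'.2, ht₂.2, ht₂'.2⟩

lemma exists_lintegral_normalized_le (m : ℕ) {A B t₁ t₂ : ℝ} (h1 : -B < t₁)
    (h2 : t₁ < A - (m : ℝ) / 2) (h3 : (m : ℝ) / 2 - B < t₂) (h4 : t₂ < A) :
    ∃ C : ℝ≥0∞, C ≠ ⊤ ∧ ∀ y ∈ lCone (m + 2),
      ∫⁻ x in lCone (m + 2), ENNReal.ofReal (invKernel m A B y x * genPow m t₁ t₂ x *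
        lDelta (m + 2) x ^ (-((m : ℝ) / 2 + 1)) * (genPow m t₁ t₂ y)⁻¹) ≤ C := by
  obtain ⟨C, hC, h⟩ := exists_lintegral_invKernel_mul_genPow_le m h1 h2 h3 h4
  refine ⟨C, hC, fun y hy => ?_⟩
  have hpos := genPow_pos t₁ t₂ hy
  simp_rw [ENNReal.ofReal_mul' (inv_nonneg.2 hpos.le)]
  rw [lintegral_mul_const' _ _ ENNReal.ofReal_ne_top]
  calc _ ≤ C * ENNReal.ofReal (genPow m t₁ t₂ y) * ENNReal.ofReal (genPow m t₁ t₂ y)⁻¹ := by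
        gcongr
        exact h y hy
    _ = C := by
        rw [mul_assoc, ← ENNReal.ofReal_mul hpos.le, mul_inv_cancel₀ hpos.ne', ENNReal.ofReal_one,
          mul_one]

lemma kernel_factorization {m : ℕ} {α β γ ν μ p q a b u v t₁ t₂ : ℝ} (hp : 1 < p) (hq : 0 < q)
    (huv : u + v = 1) (ha : a = α + μ / q) (hb : b = β + ((m : ℝ) / 2 + 1) - ν / p)
    (hγ : γ = a + b) {y x : Fin (m + 2) → ℝ} (hy : y ∈ lCone (m + 2)) (hx : x ∈ lCone (m + 2))
    (r : ℝ) :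
    ENNReal.ofReal (lDelta (m + 2) y ^ ((μ - ((m : ℝ) / 2 + 1)) / q) * lDelta (m + 2) y ^ α) *
        ENNReal.ofReal (lDelta (m + 2) (y + x) ^ (-γ) * |r| * lDelta (m + 2) x ^ β) =
      ENNReal.ofReal (invKernel m (a * u * (p / (p - 1))) (b * u * (p / (p - 1))) y x *
          genPow m (t₁ * (p / (p - 1))) (t₂ * (p / (p - 1))) x *
          lDelta (m + 2) x ^ (-((m : ℝ) / 2 + 1)) *
          (genPow m (t₁ * (p / (p - 1))) (t₂ * (p / (p - 1))) y)⁻¹) ^ (1 - 1 / p) *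
        (ENNReal.ofReal (invKernel m (b * v * q) (a * v * q) x y *
          genPow m (t₁ * q) (t₂ * q) y * lDelta (m + 2) y ^ (-((m : ℝ) / 2 + 1)) *
          (genPow m (t₁ * q) (t₂ * q) x)⁻¹) *
          ENNReal.ofReal (|r| ^ p * lDelta (m + 2) x ^ (ν - ((m : ℝ) / 2 + 1)))) ^ (1 / q) *
        ENNReal.ofReal (|r| ^ p * lDelta (m + 2) x ^ (ν - ((m : ℝ) / 2 + 1))) ^
          (1 / p - 1 / q) := by
  have hp0 : 0 < p := by linarith
  rcases eq_or_ne r 0 with rfl | hr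
  · rw [abs_zero, Real.zero_rpow hp0.ne']
    simp [hq]
  have hr := abs_pos.2 hr
  have hyx := lDelta_add_pos hy hx
  have hU := sub_pos_of_mem_lCone hy
  have hV := sub_pos_of_mem_lCone hx
  unfold invKernel genPow
  rw [add_comm x y]
  obtain ⟨hy, -⟩ := hy
  obtain ⟨hx, -⟩ := hx
  generalize |r| = r at hr
  generalize lDelta (m + 2) (y + x) = z at hyx
  generalize lDelta (m + 2) y = Y at hy
  generalize lDelta (m + 2) x = X at hx
  generalize y 0 - y 1 = U at hU
  generalize x 0 - x 1 = V at hV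
  have hp1 : p - 1 ≠ 0 := by linarith
  obtain rfl : v = 1 - u := by linarith
  rw [← ENNReal.ofReal_mul (by positivity), ← ENNReal.ofReal_mul (by positivity),
    ENNReal.ofReal_rpow_of_pos (by positivity), ENNReal.ofReal_rpow_of_pos (by positivity),
    ENNReal.ofReal_rpow_of_pos (by positivity), ← ENNReal.ofReal_mul (by positivity),
    ← ENNReal.ofReal_mul (by positivity)]
  congr 1
  obtain ⟨r, rfl⟩ := exists_exp_eq hr
  obtain ⟨z, rfl⟩ := exists_exp_eq hyx
  obtain ⟨Y, rfl⟩ := exists_exp_eq hy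
  obtain ⟨X, rfl⟩ := exists_exp_eq hx
  obtain ⟨U, rfl⟩ := exists_exp_eq hU
  obtain ⟨V, rfl⟩ := exists_exp_eq hV
  simp only [← Real.exp_add, ← Real.exp_mul, ← Real.exp_neg]
  congr 1
  subst hγ
  subst ha hb
  field_simp
  ring

lemma SBounded_of_invariant {m : ℕ} (hm : 1 ≤ m) {α β γ ν μ p q a b : ℝ} (hp : 1 < p)
    (hpq : p ≤ q) (ha : a = α + μ / q) (hb : b = β + ((m : ℝ) / 2 + 1) - ν / p) (hγ : γ = a + b)
    (ha₁ : (m : ℝ) / 2 * (1 - 1 / p) < a) (ha₂ : (m : ℝ) / 2 * (1 / q) < a)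
    (hb₁ : (m : ℝ) / 2 * (1 - 1 / p) < b) (hb₂ : (m : ℝ) / 2 * (1 / q) < b) :
    SBounded (m + 2) α β γ p ν q μ := by
  have hp0 : 0 < p := by linarith
  have hq0 : 0 < q := by linarith
  have hp1 : 0 < p - 1 := by linarith
  have hm0 : (0 : ℝ) < m := by exact_mod_cast hm
  have hpp : 0 < 1 - 1 / p := by
    rw [sub_pos, div_lt_one hp0]
    exact hp
  have hc0 : 0 < p / (p - 1) := by positivity
  have hc : (1 - 1 / p) * (p / (p - 1)) = 1 := by field_simp
  obtain ⟨u, v, t₁, t₂, huv, i1, i2, i3, i4, i5, i6, i7, i8⟩ :=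
    exists_schur_exponents (by positivity) (by positivity) ha₁ ha₂ hb₁ hb₂
  obtain ⟨C₁, hC₁, H₁⟩ := exists_lintegral_normalized_le m
    (A := a * u * (p / (p - 1))) (B := b * u * (p / (p - 1)))
    (t₁ := t₁ * (p / (p - 1))) (t₂ := t₂ * (p / (p - 1)))
    (by nlinarith [mul_lt_mul_of_pos_right i1 hc0])
    (by linear_combination mul_lt_mul_of_pos_right i2 hc0 - (m : ℝ) / 2 * hc)
    (by linear_combination mul_lt_mul_of_pos_right i3 hc0 - (m : ℝ) / 2 * hc)
    (mul_lt_mul_of_pos_right i4 hc0)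
  have hqq : 1 / q * q = 1 := one_div_mul_cancel hq0.ne'
  obtain ⟨C₂, hC₂, H₂⟩ := exists_lintegral_normalized_le m
    (A := b * v * q) (B := a * v * q) (t₁ := t₁ * q) (t₂ := t₂ * q)
    (by nlinarith [mul_lt_mul_of_pos_right i5 hq0])
    (by linear_combination mul_lt_mul_of_pos_right i6 hq0 - (m : ℝ) / 2 * hqq)
    (by linear_combination mul_lt_mul_of_pos_right i7 hq0 - (m : ℝ) / 2 * hqq)
    (mul_lt_mul_of_pos_right i8 hq0)
  set D := C₁ ^ (1 - 1 / p) * C₂ ^ (1 / q) with hD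
  have hDtop : D ≠ ⊤ := ENNReal.mul_ne_top (ENNReal.rpow_ne_top_of_nonneg hpp.le hC₁)
    (ENNReal.rpow_ne_top_of_nonneg (by positivity) hC₂)
  refine ⟨D.toReal + 1, by positivity, fun g hg _ => ?_⟩
  have hcast : ((m + 2 : ℕ) : ℝ) / 2 = (m : ℝ) / 2 + 1 := by
    push_cast
    ring
  have hΔ := measurable_lDelta (m + 2)
  have hinv (A B : ℝ) : Measurable fun z : (Fin (m + 2) → ℝ) × (Fin (m + 2) → ℝ) =>
      invKernel m A B z.1 z.2 := by
    unfold invKernel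
    fun_prop
  have hgen := measurable_genPow m
  have key := lintegral_rpow_le_of_factorization (ρ := volume.restrict (lCone (m + 2))) hp hpq
    (f₁ := fun y x => ENNReal.ofReal
      (invKernel m (a * u * (p / (p - 1))) (b * u * (p / (p - 1))) y x *
          genPow m (t₁ * (p / (p - 1))) (t₂ * (p / (p - 1))) x *
          lDelta (m + 2) x ^ (-((m : ℝ) / 2 + 1)) *
          (genPow m (t₁ * (p / (p - 1))) (t₂ * (p / (p - 1))) y)⁻¹))
    (f₂ := fun y x => ENNReal.ofReal (invKernel m (b * v * q) (a * v * q) x y *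
          genPow m (t₁ * q) (t₂ * q) y * lDelta (m + 2) y ^ (-((m : ℝ) / 2 + 1)) *
          (genPow m (t₁ * q) (t₂ * q) x)⁻¹))
    (f₃ := fun x => ENNReal.ofReal (|g x| ^ p * lDelta (m + 2) x ^ (ν - ((m : ℝ) / 2 + 1))))
    (by
      have h₁ := hinv (a * u * (p / (p - 1))) (b * u * (p / (p - 1)))
      have h₂ := hgen (t₁ * (p / (p - 1))) (t₂ * (p / (p - 1)))
      unfold Function.uncurry
      fun_prop)
    (by
      have h₁ := (hinv (b * v * q) (a * v * q)).comp measurable_swap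
      have h₂ := hgen (t₁ * q) (t₂ * q)
      refine ENNReal.measurable_ofReal.comp (((h₁.mul ?_).mul ?_).mul ?_) <;> fun_prop)
    (by fun_prop)
    ((ae_restrict_mem (measurableSet_lCone _)).mono H₁)
    ((ae_restrict_mem (measurableSet_lCone _)).mono H₂)
  have hS : ∫⁻ y in lCone (m + 2), Sop (m + 2) α β γ g y ^ q *
      ENNReal.ofReal (lDelta (m + 2) y ^ (μ - ((m + 2 : ℕ) : ℝ) / 2)) ≤
      (C₁ ^ (1 - 1 / p)) ^ q * C₂ * (∫⁻ x in lCone (m + 2),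
        ENNReal.ofReal (|g x| ^ p * lDelta (m + 2) x ^ (ν - ((m : ℝ) / 2 + 1)))) ^ (q / p) := by
    refine le_of_eq_of_le (setLIntegral_congr_fun (measurableSet_lCone _) fun y hy => ?_) key
    have hy0 := hy.1
    have hw : ENNReal.ofReal (lDelta (m + 2) y ^ (μ - ((m + 2 : ℕ) : ℝ) / 2)) =
        ENNReal.ofReal (lDelta (m + 2) y ^ ((μ - ((m : ℝ) / 2 + 1)) / q)) ^ q := by
      rw [ENNReal.ofReal_rpow_of_pos (by positivity), ← Real.rpow_mul hy0.le,
        div_mul_cancel₀ _ hq0.ne', hcast]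
    rw [hw, ← ENNReal.mul_rpow_of_nonneg _ _ hq0.le, Sop, mul_right_comm,
      mul_comm (ENNReal.ofReal (lDelta (m + 2) y ^ α)),
      ← ENNReal.ofReal_mul (by positivity),
      ← lintegral_const_mul' _ _ ENNReal.ofReal_ne_top]
    congr 1
    exact setLIntegral_congr_fun (measurableSet_lCone _) fun x hx =>
      kernel_factorization hp hq0 huv ha hb hγ hy hx (g x)
  unfold SopNorm coneNorm
  rw [hcast] at hS ⊢
  calc _ ≤ _ := ENNReal.rpow_le_rpow hS (by positivity)
    _ = D * (∫⁻ x in lCone (m + 2),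
        ENNReal.ofReal (|g x| ^ p * lDelta (m + 2) x ^ (ν - ((m : ℝ) / 2 + 1)))) ^ (1 / p) := by
      rw [ENNReal.mul_rpow_of_nonneg _ _ (by positivity),
        ENNReal.mul_rpow_of_nonneg _ _ (by positivity), ← ENNReal.rpow_mul _ q,
        mul_one_div_cancel hq0.ne', ENNReal.rpow_one, ← ENNReal.rpow_mul]
      congr 2
      field_simp
    _ ≤ _ := by
      gcongr
      calc D = ENNReal.ofReal D.toReal := (ENNReal.ofReal_toReal hDtop).symm
        _ ≤ _ := ENNReal.ofReal_le_ofReal (by linarith)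

/-- Lemma 4.1 of the paper on the rank-2 Lorentz cone (sufficiency). -/
theorem statement10 (n : ℕ) [NeZero n] (hn : 3 ≤ n) (α β γ ν μ p q : ℝ)
    (hp : 1 < p) (hpq : p ≤ q)
    (h : ν / (p / (p - 1)) + μ / q > 0)
    (h1 : γ = α + β + (n : ℝ) / 2 - ν / p + μ / q)
    (h2 : p * (β - γ + (n : ℝ) - 1) - (n : ℝ) / 2 + 1 < ν)
    (h3 : ν < p * (β + 1) + (n : ℝ) / 2 - 1)
    (h4 : (n : ℝ) / 2 - 1 - q * α < μ)
    (h5 : μ < q * (γ - α) - (n : ℝ) / 2 + 1) :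
    SBounded n α β γ p ν q μ := by
  obtain ⟨m, rfl⟩ : ∃ m, n = m + 2 := ⟨n - 2, by omega⟩
  obtain rfl : ‹NeZero (m + 2)› = ⟨Nat.succ_ne_zero _⟩ := Subsingleton.elim _ _
  have hp0 : 0 < p := by linarith
  have hq0 : 0 < q := by linarith
  push_cast at h1 h2 h3 h4 h5
  have hν : ν = ν / p * p := by field_simp
  have hμ : μ = μ / q * q := by field_simp
  refine SBounded_of_invariant (by omega) hp hpq rfl rfl (by linarith) ?_ ?_ ?_ ?_ <;>
    generalize ν / p = ν' at * <;> generalize μ / q = μ' at * <;> subst hν <;> subst hμ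
  · have : β - γ + m + 1 - ν' < m / 2 * (1 / p) := by
      rw [mul_one_div, lt_div_iff₀ hp0]
      linarith
    linarith
  · rw [mul_one_div, div_lt_iff₀ hq0]
    linarith
  · have : ν' - β - 1 < m / 2 * (1 / p) := by
      rw [mul_one_div, lt_div_iff₀ hp0]
      linarith
    linarith
  · rw [mul_one_div, div_lt_iff₀ hq0]
    subst h1
    linarith
end
end
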